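/- The kernel M_d^δ = {m ∈ M_d : δ(m) = 0} is a finitely generated module over the algebra of constants K[U_d,V_d]^δ = {h ∈ K[U_d,V_d] : δ(h) = 0}. -/

import Mathlib

noncomputable section

/-- `K[U_d,V_d]`. -/
abbrev PolyUV (K : Type*) [CommRing K] (d : ℕ) := MvPolynomial (Fin d ⊕ Fin d) K

def uP (K : Type*) [CommRing K] (d : ℕ) (i : Fin d) : PolyUV K d := MvPolynomial.X (Sum.inl i)
def vP (K : Type*) [CommRing K] (d : ℕ) (i : Fin d) : PolyUV K d := MvPolynomial.X (Sum.inr i)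

/-- The free `K[U_d,V_d]`-module `M_d = ⊕ a_i K[U_d,V_d]` of rank `d`,
realized as `Fin d → K[U_d,V_d]` (the `i`-th coordinate is the coefficient of `a_i`). -/
abbrev Md (K : Type*) [CommRing K] (d : ℕ) := Fin d → PolyUV K d

/-- The extension of `δ` to `M_d`, determined by
`δ(a_j·h) = (Σ_i α_{ij} a_i)·h + a_j·δ(h)`. -/
def deltaM (K : Type*) [CommRing K] (d : ℕ) (α : Matrix (Fin d) (Fin d) K)
    (δ' : Derivation K (PolyUV K d) (PolyUV K d)) (m : Md K d) : Md K d :=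
  fun i => (∑ j, α i j • m j) + δ' (m i)


section jordan

open Module Polynomial

structure SlTwo {K V : Type*} [Field K] [AddCommGroup V] [Module K V]
    (E F H : Module.End K V) : Prop where
  ef : ∀ v, E (F v) = F (E v) + H v
  he : ∀ v, H (E v) = E (H v) + (2 : K) • E v
  hf : ∀ v, H (F v) = F (H v) - (2 : K) • F v
  ne : ∀ v, ∃ k : ℕ, (E ^ k) v = 0
  nf : ∀ v, ∃ k : ℕ, (F ^ k) v = 0
  wt : ∀ v, v ∈ ⨆ p : ℤ, Module.End.eigenspace H (p : K)

theorem pow_zero_mono {K V : Type*} [Field K] [AddCommGroup V] [Module K V]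
    (T : Module.End K V) {v : V} {k l : ℕ} (h : k ≤ l) (hk : (T ^ k) v = 0) : (T ^ l) v = 0 := by
  obtain ⟨c, rfl⟩ := Nat.exists_eq_add_of_le h
  rw [add_comm, pow_add, Module.End.mul_apply, hk, map_zero]

/-- the submodule of locally nilpotent vectors -/
def lnil {K V : Type*} [Field K] [AddCommGroup V] [Module K V]
    (T : Module.End K V) : Submodule K V where
  carrier := {v | ∃ k : ℕ, (T ^ k) v = 0}
  zero_mem' := ⟨0, by simp⟩
  add_mem' := by
    rintro a b ⟨k, hk⟩ ⟨l, hl⟩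
    refine ⟨max k l, ?_⟩
    rw [map_add, pow_zero_mono T (le_max_left k l) hk, pow_zero_mono T (le_max_right k l) hl,
      add_zero]
  smul_mem' := by
    rintro c a ⟨k, hk⟩
    exact ⟨k, by rw [map_smul, hk, smul_zero]⟩

theorem mem_lnil {K V : Type*} [Field K] [AddCommGroup V] [Module K V]
    {T : Module.End K V} {v : V} : v ∈ lnil T ↔ ∃ k : ℕ, (T ^ k) v = 0 := Iff.rfl

/-- the span of integral weight vectors -/
def wts {K V : Type*} [Field K] [AddCommGroup V] [Module K V]
    (T : Module.End K V) : Submodule K V := ⨆ p : ℤ, Module.End.eigenspace T (p : K)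

theorem mem_wts_of {K V : Type*} [Field K] [AddCommGroup V] [Module K V]
    {T : Module.End K V} {v : V} (p : ℤ) (h : T v = (p : K) • v) : v ∈ wts T :=
  Submodule.mem_iSup_of_mem p (Module.End.mem_eigenspace_iff.2 h)

section transfer
variable {K V W : Type*} [Field K] [AddCommGroup V] [Module K V] [AddCommGroup W] [Module K W]

theorem pow_transfer (j : V →ₗ[K] W) {T : Module.End K V} {T' : Module.End K W}
    (h : ∀ v, T' (j v) = j (T v)) (k : ℕ) (v : V) : (T' ^ k) (j v) = j ((T ^ k) v) := by
  induction k with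
  | zero => simp
  | succ k ih => rw [pow_succ', pow_succ', Module.End.mul_apply, ih, h, Module.End.mul_apply]

theorem lnil_transfer (j : V →ₗ[K] W) {T : Module.End K V} {T' : Module.End K W}
    (h : ∀ v, T' (j v) = j (T v)) {v : V} (hv : v ∈ lnil T) : j v ∈ lnil T' := by
  obtain ⟨k, hk⟩ := hv
  exact ⟨k, by rw [pow_transfer j h, hk, map_zero]⟩

theorem wts_transfer (j : V →ₗ[K] W) {T : Module.End K V} {T' : Module.End K W}
    (h : ∀ v, T' (j v) = j (T v)) {v : V} (hv : v ∈ wts T) : j v ∈ wts T' := by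
  have : wts T ≤ (wts T').comap j := by
    refine iSup_le fun p w hw => ?_
    rw [Module.End.mem_eigenspace_iff] at hw
    exact mem_wts_of p (by rw [h, hw, map_smul])
  exact this hv

/-- Transport along a surjection. -/
theorem SlTwo.transfer {E F H : Module.End K V} {E' F' H' : Module.End K W} (s : SlTwo E F H)
    (j : V →ₗ[K] W) (hj : Function.Surjective j)
    (hE : ∀ v, E' (j v) = j (E v)) (hF : ∀ v, F' (j v) = j (F v))
    (hH : ∀ v, H' (j v) = j (H v)) : SlTwo E' F' H' where
  ef := hj.forall.2 fun v => by simp only [hE, hF, hH, s.ef, map_add]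
  he := hj.forall.2 fun v => by simp only [hE, hF, hH, s.he, map_add, map_smul]
  hf := hj.forall.2 fun v => by simp only [hE, hF, hH, s.hf, map_sub, map_smul]
  ne := hj.forall.2 fun v => lnil_transfer j hE (s.ne v)
  nf := hj.forall.2 fun v => lnil_transfer j hF (s.nf v)
  wt := hj.forall.2 fun v => wts_transfer j hH (s.wt v)

end transfer

/-- finite products -/
theorem SlTwo.pi {K ι : Type*} [Field K] [Fintype ι] [DecidableEq ι] {V : ι → Type*}
    [∀ i, AddCommGroup (V i)] [∀ i, Module K (V i)]
    {E F H : ∀ i, Module.End K (V i)} (s : ∀ i, SlTwo (E i) (F i) (H i)) :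
    SlTwo (K := K) (V := ∀ i, V i) (LinearMap.piMap E) (LinearMap.piMap F)
      (LinearMap.piMap H) where
  ef v := by ext i; simp [(s i).ef]
  he v := by ext i; simp [(s i).he]
  hf v := by ext i; simp [(s i).hf]
  ne v := by
    rw [← mem_lnil, ← Finset.univ_sum_single v]
    refine Submodule.sum_mem _ fun i _ => lnil_transfer (LinearMap.single K V i) ?_ ((s i).ne _)
    intro w; ext j
    by_cases h : i = j
    · subst h; simp
    · simp [Pi.single_eq_of_ne' h]
  nf v := by
    rw [← mem_lnil, ← Finset.univ_sum_single v]
    refine Submodule.sum_mem _ fun i _ => lnil_transfer (LinearMap.single K V i) ?_ ((s i).nf _)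
    intro w; ext j
    by_cases h : i = j
    · subst h; simp
    · simp [Pi.single_eq_of_ne' h]
  wt v := by
    change v ∈ wts _
    rw [← Finset.univ_sum_single v]
    refine Submodule.sum_mem _ fun i _ => wts_transfer (LinearMap.single K V i) ?_ ((s i).wt _)
    intro w; ext j
    by_cases h : i = j
    · subst h; simp
    · simp [Pi.single_eq_of_ne' h]

section block
variable (K : Type*) [Field K] (k : ℕ)

def polyE : Module.End K K[X] := LinearMap.mulLeft K X
def polyF : Module.End K K[X] :=
  ((k : K) - 1) • derivative - (LinearMap.mulLeft K X) ∘ₗ derivative ∘ₗ derivative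
def polyH : Module.End K K[X] :=
  (2 : K) • (LinearMap.mulLeft K X) ∘ₗ derivative - ((k : K) - 1) • LinearMap.id

abbrev blockI : Submodule K K[X] := (Submodule.span K[X] {(X : K[X]) ^ k}).restrictScalars K

theorem mem_blockI {p : K[X]} : p ∈ blockI K k ↔ X ^ k ∣ p := by
  rw [Submodule.restrictScalars_mem, Submodule.mem_span_singleton, dvd_def]
  simp only [smul_eq_mul, mul_comm (X ^ k), eq_comm]

theorem blockE : blockI K k ≤ (blockI K k).comap (polyE K) := by
  intro p hp
  rw [Submodule.mem_comap, mem_blockI] at *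
  exact hp.mul_left _

theorem polyE_mon (j : ℕ) (c : K) : polyE K (monomial j c) = monomial (j + 1) c := by
  simp [polyE, X_mul_monomial]

theorem polyF_mon (j : ℕ) (c : K) :
    polyF K k (monomial j c) = monomial (j - 1) (c * j * (k - j)) := by
  rcases j with _ | _ | j
  · simp [polyF, derivative_monomial]
  · simp [polyF, derivative_monomial, smul_monomial]; ring_nf
  · simp only [polyF, LinearMap.sub_apply, LinearMap.smul_apply, LinearMap.comp_apply,
      derivative_monomial, smul_monomial, LinearMap.mulLeft_apply, X_mul_monomial]
    simp only [Nat.add_sub_cancel, ← map_sub]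
    congr 1
    push_cast
    simp only [smul_eq_mul]
    ring

theorem polyH_mon (j : ℕ) (c : K) :
    polyH K k (monomial j c) = monomial j (c * (2 * j - k + 1)) := by
  rcases j with _ | j
  · simp only [polyH, LinearMap.sub_apply, LinearMap.smul_apply, LinearMap.comp_apply,
      derivative_monomial, smul_monomial, LinearMap.id_apply]
    simp only [Nat.cast_zero, mul_zero, map_zero, smul_zero, zero_sub, ← map_neg]
    congr 1
    simp only [smul_eq_mul]
    ring
  · simp only [polyH, LinearMap.sub_apply, LinearMap.smul_apply, LinearMap.comp_apply,
      derivative_monomial, smul_monomial, LinearMap.mulLeft_apply, X_mul_monomial,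
      LinearMap.id_apply]
    simp only [Nat.add_sub_cancel, ← map_sub]
    congr 1
    push_cast
    simp only [smul_eq_mul]
    ring

theorem blockH : blockI K k ≤ (blockI K k).comap (polyH K k) := by
  intro p hp
  rw [mem_blockI] at hp
  obtain ⟨q, rfl⟩ := hp
  induction q using Polynomial.induction_on' with
  | add p q hp hq => rw [mul_add]; exact Submodule.add_mem _ hp hq
  | monomial n a =>
    rw [Submodule.mem_comap, mem_blockI, X_pow_mul_monomial, polyH_mon, ← X_pow_mul_monomial]
    exact dvd_mul_right _ _

theorem blockF : blockI K k ≤ (blockI K k).comap (polyF K k) := by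
  intro p hp
  rw [mem_blockI] at hp
  obtain ⟨q, rfl⟩ := hp
  induction q using Polynomial.induction_on' with
  | add p q hp hq => rw [mul_add]; exact Submodule.add_mem _ hp hq
  | monomial n a =>
    rw [Submodule.mem_comap, mem_blockI, X_pow_mul_monomial, polyF_mon]
    rcases n with _ | n
    · simp
    · rw [show n + 1 + k - 1 = n + k by omega, ← X_pow_mul_monomial]
      exact dvd_mul_right _ _

theorem endo_ext {V : Type*} [AddCommGroup V] [Module K V] {f g : K[X] →ₗ[K] V}
    (h : ∀ j c, f (monomial j c) = g (monomial j c)) (p : K[X]) : f p = g p := by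
  induction p using Polynomial.induction_on' with
  | add p q hp hq => rw [map_add, map_add, hp, hq]
  | monomial n a => exact h n a

theorem slTwo_block : SlTwo ((blockI K k).mapQ _ (polyE K) (blockE K k))
    ((blockI K k).mapQ _ (polyF K k) (blockF K k))
    ((blockI K k).mapQ _ (polyH K k) (blockH K k)) where
  ef := (blockI K k).mkQ_surjective.forall.2 fun v => by
    have : polyE K (polyF K k v) = polyF K k (polyE K v) + polyH K k v := by
      refine endo_ext K (f := polyE K ∘ₗ polyF K k)
        (g := polyF K k ∘ₗ polyE K + polyH K k) (fun j c => ?_) v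
      simp only [LinearMap.comp_apply, LinearMap.add_apply, polyE_mon, polyF_mon, polyH_mon]
      rcases j with _ | j
      · simp only [← map_add]
        simp only [Nat.cast_zero, mul_zero, zero_mul, map_zero, zero_add, Nat.add_sub_cancel,
          ← map_add, Nat.cast_one]
        rw [eq_comm]
        exact (monomial_eq_zero_iff _ _).2 (by ring)
      · simp only [Nat.add_sub_cancel, ← map_add]
        congr 1; push_cast; ring
    simpa using congrArg (blockI K k).mkQ this
  he := (blockI K k).mkQ_surjective.forall.2 fun v => by
    have : polyH K k (polyE K v) = polyE K (polyH K k v) + (2 : K) • polyE K v := by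
      refine endo_ext K (f := polyH K k ∘ₗ polyE K)
        (g := polyE K ∘ₗ polyH K k + (2 : K) • polyE K) (fun j c => ?_) v
      simp only [LinearMap.comp_apply, LinearMap.add_apply, polyE_mon, polyH_mon,
        LinearMap.smul_apply, smul_monomial, ← map_add]
      congr 1; push_cast; simp only [smul_eq_mul]; ring
    simpa using congrArg (blockI K k).mkQ this
  hf := (blockI K k).mkQ_surjective.forall.2 fun v => by
    have : polyH K k (polyF K k v) = polyF K k (polyH K k v) - (2 : K) • polyF K k v := by
      refine endo_ext K (f := polyH K k ∘ₗ polyF K k)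
        (g := polyF K k ∘ₗ polyH K k - (2 : K) • polyF K k) (fun j c => ?_) v
      simp only [LinearMap.comp_apply, LinearMap.sub_apply, polyF_mon, polyH_mon,
        LinearMap.smul_apply, smul_monomial, ← map_sub]
      rcases j with _ | j
      · simp
      · congr 1; push_cast [Nat.add_sub_cancel]; simp only [smul_eq_mul]; ring
    simpa using congrArg (blockI K k).mkQ this
  ne := (blockI K k).mkQ_surjective.forall.2 fun v => by
    refine ⟨k, ?_⟩
    rw [pow_transfer (blockI K k).mkQ (T := polyE K) (fun v => by simp)]
    have : ∀ n : ℕ, (polyE K ^ n) v = X ^ n * v := by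
      intro n
      induction n with
      | zero => simp
      | succ n ih => rw [pow_succ', Module.End.mul_apply, ih, polyE, LinearMap.mulLeft_apply]; ring
    rw [this, Submodule.mkQ_apply, Submodule.Quotient.mk_eq_zero, mem_blockI]
    exact dvd_mul_right _ _
  nf := (blockI K k).mkQ_surjective.forall.2 fun v => by
    refine lnil_transfer (blockI K k).mkQ (T := polyF K k) (fun v => by simp) ?_
    induction v using Polynomial.induction_on' with
    | add p q hp hq => exact Submodule.add_mem _ hp hq
    | monomial n a =>
      refine ⟨n + 1, ?_⟩
      induction n generalizing a with
      | zero => rw [zero_add, pow_one, polyF_mon]; simp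
      | succ n ih => rw [pow_succ, Module.End.mul_apply, polyF_mon, Nat.add_sub_cancel, ih]
  wt := (blockI K k).mkQ_surjective.forall.2 fun v => by
    refine wts_transfer (blockI K k).mkQ (T := polyH K k) (fun v => by simp) ?_
    induction v using Polynomial.induction_on' with
    | add p q hp hq => exact Submodule.add_mem _ hp hq
    | monomial n a =>
      refine mem_wts_of (2 * n - k + 1) ?_
      rw [polyH_mon, smul_monomial]
      congr 1; push_cast; simp only [smul_eq_mul]; ring

end block

/-- Jacobson-Morozov for nilpotent endomorphisms (only existence of the triple). -/
theorem exists_slTwo {K V : Type*} [Field K] [AddCommGroup V] [Module K V] [Module.Finite K V]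
    (T : Module.End K V) (hT : IsNilpotent T) : ∃ F H : Module.End K V, SlTwo T F H := by
  obtain ⟨n, hn⟩ := hT
  have htor : Module.IsTorsion' (AEval K V T) (Submonoid.powers (X : K[X])) := by
    intro v
    refine ⟨⟨X ^ n, n, rfl⟩, ?_⟩
    obtain ⟨w, rfl⟩ := (AEval.of K V T).surjective v
    change (X : K[X]) ^ n • (AEval.of K V T w) = _
    rw [AEval.X_pow_smul_of, hn, zero_smul, map_zero]
  obtain ⟨d, k, ⟨e⟩⟩ := Module.torsion_by_prime_power_decomposition
    (Polynomial.irreducible_X (R := K)) htor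
  have s := SlTwo.pi (fun i => slTwo_block K (k i))
  let e1 : AEval K V T ≃ₗ[K[X]] (∀ i, K[X] ⧸ Submodule.span K[X] {(X : K[X]) ^ k i}) :=
    e.trans (DirectSum.linearEquivFunOnFintype _ _ _)
  let e2 : (∀ i, K[X] ⧸ blockI K (k i)) ≃ₗ[K] V :=
    LinearEquiv.trans (e1.restrictScalars K).symm (AEval.of K V T).symm
  refine ⟨e2.conj (LinearMap.piMap fun i => (blockI K (k i)).mapQ _ (polyF K (k i)) (blockF K (k i))),
    e2.conj (LinearMap.piMap fun i => (blockI K (k i)).mapQ _ (polyH K (k i)) (blockH K (k i))),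
    s.transfer e2.toLinearMap e2.surjective ?_ ?_ ?_⟩
  · intro v
    have h1 : (LinearMap.piMap fun i => (blockI K (k i)).mapQ _ (polyE K) (blockE K (k i))) v
        = (X : K[X]) • (show ∀ i, K[X] ⧸ Submodule.span K[X] {(X : K[X]) ^ k i} from v) := by
      ext i
      have h0 : ∀ w : K[X] ⧸ blockI K (k i),
          (blockI K (k i)).mapQ _ (polyE K) (blockE K (k i)) w
          = (X : K[X]) • (show K[X] ⧸ Submodule.span K[X] {(X : K[X]) ^ k i} from w) :=
        (blockI K (k i)).mkQ_surjective.forall.2 fun w => rfl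
      exact h0 (v i)
    have h2 : ∀ w, T ((AEval.of K V T).symm (e1.symm w))
        = (AEval.of K V T).symm (e1.symm ((X : K[X]) • w)) := by
      intro w
      rw [map_smul, AEval.of_symm_X_smul]
      rfl
    rw [h1]
    exact h2 v
  · intro v; simp [LinearEquiv.conj_apply]
  · intro v; simp [LinearEquiv.conj_apply]

end jordan

section abstract
variable {K V : Type*} [Field K] [AddCommGroup V] [Module K V] {E F H : Module.End K V}

theorem SlTwo.ef_pow (s : SlTwo E F H) (k : ℕ) (v : V) :
    E ((F ^ (k + 1)) v) = (F ^ (k + 1)) (E v) + ((k : K) + 1) • (F ^ k) (H v)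
      - (((k : K) + 1) * k) • (F ^ k) v := by
  induction k generalizing v with
  | zero => simp [s.ef]
  | succ k ih =>
    rw [pow_succ F (k + 1), Module.End.mul_apply, ih, s.ef, s.hf, Module.End.mul_apply,
      pow_succ F k, Module.End.mul_apply, Module.End.mul_apply, Module.End.mul_apply,
      Module.End.mul_apply]
    simp only [map_add, map_sub, map_smul, Nat.cast_add, Nat.cast_one]
    module

theorem SlTwo.h_pow (s : SlTwo E F H) (k : ℕ) (v : V) (p : K) (hv : H v = p • v) :
    H ((E ^ k) v) = (p + 2 * k) • (E ^ k) v := by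
  induction k with
  | zero => simp [hv]
  | succ k ih =>
    rw [pow_succ', Module.End.mul_apply, s.he, ih, map_smul]
    push_cast
    module

theorem SlTwo.hw [CharZero K] (s : SlTwo E F H) {v : V} (p : ℤ) (hE : E v = 0)
    (hH : H v = (p : K) • v) (hv : v ≠ 0) : ∃ n : ℕ, p = n ∧ (F ^ (n + 1)) v = 0 := by
  classical
  have hex := s.nf v
  have h1 := Nat.find_spec hex
  have h2 : ∀ m < Nat.find hex, ¬ (F ^ m) v = 0 := fun m hm => Nat.find_min hex hm
  generalize Nat.find hex = k at h1 h2
  rcases k with _ | k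
  · exact absurd (by simpa using h1) hv
  · refine ⟨k, ?_, h1⟩
    have h3 := s.ef_pow k v
    rw [h1, hE, hH, map_zero, map_zero, map_smul, zero_add, smul_smul, ← sub_smul] at h3
    have h4 := (smul_eq_zero.1 h3.symm).resolve_right (h2 k (Nat.lt_succ_self k))
    have h5 : ((k : K) + 1) * ((p : K) - k) = 0 := by rw [← h4]; ring
    have h6 := (mul_eq_zero.1 h5).resolve_left (Nat.cast_add_one_ne_zero k)
    exact_mod_cast sub_eq_zero.1 h6

def rc (K : Type*) [Field K] (k : ℕ) : K := (-1) ^ k / ((k.factorial : K) * ((k + 1).factorial : K))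

theorem rc_succ [CharZero K] (k : ℕ) : rc K (k + 1) * (((k : K) + 1) * (k + 2)) = - rc K k := by
  unfold rc
  have h1 : (k.factorial : K) ≠ 0 := Nat.cast_ne_zero.2 k.factorial_ne_zero
  have h2 : (k : K) + 1 ≠ 0 := Nat.cast_add_one_ne_zero k
  have h3 : (k : K) + 1 + 1 ≠ 0 := by exact_mod_cast Nat.cast_add_one_ne_zero (R := K) (k + 1)
  simp only [Nat.factorial_succ]
  push_cast
  field_simp
  ring

/-- truncated Reynolds operator -/
def reyn (E F : Module.End K V) (m : ℕ) (v : V) : V :=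
  ∑ k ∈ Finset.range m, rc K k • (F ^ k) ((E ^ k) v)

theorem SlTwo.reyn_aux [CharZero K] (s : SlTwo E F H) (m : ℕ) (v : V) (hv : H v = 0) :
    E (reyn E F (m + 1) v) = rc K m • (F ^ m) ((E ^ (m + 1)) v) := by
  induction m with
  | zero => simp [reyn]
  | succ m ih =>
    have h0 : H v = (0 : K) • v := by rw [hv, zero_smul]
    unfold reyn at ih ⊢
    rw [Finset.sum_range_succ, map_add, ih, map_smul, s.ef_pow, s.h_pow _ v 0 h0, map_smul]
    rw [pow_succ' E (m + 1), Module.End.mul_apply]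
    have h := rc_succ (K := K) m
    have : rc K m = -(rc K (m + 1) * (((m : K) + 1) * (m + 2))) := by rw [h, neg_neg]
    rw [this]
    push_cast
    module

theorem SlTwo.reyn_E [CharZero K] (s : SlTwo E F H) (m : ℕ) (v : V) (hv : H v = 0)
    (hm : (E ^ m) v = 0) : E (reyn E F m v) = 0 := by
  rcases m with _ | m
  · simp [reyn]
  · rw [s.reyn_aux m v hv, hm, map_zero, smul_zero]

theorem wt_indep [CharZero K] (T : Module.End K V) (s : Finset ℤ) (f : ℤ → V)
    (hf : ∀ p, T (f p) = (p : K) • f p) (h : ∑ p ∈ s, f p = 0) : ∀ p ∈ s, f p = 0 := by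
  have h1 : iSupIndep fun p : ℤ => Module.End.eigenspace T (p : K) :=
    (Module.End.eigenspaces_iSupIndep T).comp Int.cast_injective
  have h2 := (iSupIndep_iff_finsetSum_eq_zero_imp_eq_zero _).1 h1
  exact h2 s f (fun p _ => Module.End.mem_eigenspace_iff.2 (hf p)) h

theorem wt_decomp (T : Module.End K V) {v : V} (hv : v ∈ wts T) :
    ∃ (s : Finset ℤ) (f : ℤ → V), (∀ p, T (f p) = (p : K) • f p) ∧ v = ∑ p ∈ s, f p := by
  classical
  obtain ⟨f, hf, h⟩ := (Submodule.mem_iSup_iff_exists_finsupp _ _).1 hv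
  exact ⟨f.support, f, fun p => Module.End.mem_eigenspace_iff.1 (hf p), h.symm⟩

end abstract

section leibniz
variable {K R N : Type*} [Field K] [CommRing R] [Algebra K R] [AddCommGroup N] [Module K N]
  [Module R N] [IsScalarTower K R N] {D : Derivation K R R} {T : Module.End K N}

theorem lnil_smul (hT : ∀ (b : R) (n : N), T (b • n) = D b • n + b • T n) {b : R} {n : N}
    (hb : b ∈ lnil (D : R →ₗ[K] R)) (hn : n ∈ lnil T) : b • n ∈ lnil T := by
  obtain ⟨k, hk⟩ := hb
  obtain ⟨l, hl⟩ := hn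
  have key : ∀ s k l : ℕ, k + l = s → ∀ (b : R) (n : N), ((D : R →ₗ[K] R) ^ k) b = 0 →
      (T ^ l) n = 0 → (T ^ s) (b • n) = 0 := by
    intro s
    induction s with
    | zero =>
      intro k l h b n hb _
      obtain rfl : k = 0 := by omega
      have : b = 0 := by simpa using hb
      simp [this]
    | succ s ih =>
      intro k l h b n hb hn
      rcases k with _ | k
      · have : b = 0 := by simpa using hb
        simp [this]
      rcases l with _ | l
      · have : n = 0 := by simpa using hn
        simp [this]
      rw [pow_succ, Module.End.mul_apply, hT, map_add]
      rw [ih k (l + 1) (by omega) (D b) n (by simpa [pow_succ] using hb) hn,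
        ih (k + 1) l (by omega) b (T n) hb (by simpa [pow_succ] using hn), add_zero]
  exact ⟨k + l, key _ k l rfl b n hk hl⟩

theorem wts_smul (hT : ∀ (b : R) (n : N), T (b • n) = D b • n + b • T n) {b : R} {n : N}
    (hb : b ∈ wts (D : R →ₗ[K] R)) (hn : n ∈ wts T) : b • n ∈ wts T := by
  obtain ⟨s, f, hf, rfl⟩ := wt_decomp _ hb
  obtain ⟨t, g, hg, rfl⟩ := wt_decomp _ hn
  rw [Finset.sum_smul]
  refine Submodule.sum_mem _ fun p _ => ?_
  rw [Finset.smul_sum]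
  refine Submodule.sum_mem _ fun q _ => mem_wts_of (p + q) ?_
  have h1 : D (f p) = (p : K) • f p := hf p
  rw [hT, h1, hg, smul_assoc, smul_comm (f p) (q : K), ← add_smul]
  push_cast
  rfl

end leibniz

section poly
variable {K σ : Type*} [Field K] [Fintype σ] [DecidableEq σ]

open MvPolynomial

def polyD (L : Matrix σ σ K) : Derivation K (MvPolynomial σ K) (MvPolynomial σ K) :=
  mkDerivation K fun j => ∑ i, L i j • X i

def linX : (σ → K) →ₗ[K] MvPolynomial σ K := Fintype.linearCombination K X

theorem linX_single (j : σ) : linX (K := K) (Pi.single j 1) = X j := by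
  simp [linX]

theorem polyD_X (L : Matrix σ σ K) (j : σ) : polyD L (X j) = ∑ i, L i j • X i :=
  mkDerivation_X _ _ _

theorem polyD_linX (L : Matrix σ σ K) (w : σ → K) :
    polyD L (linX w) = linX (Matrix.toLin' L w) := by
  simp only [linX, Fintype.linearCombination_apply, map_sum, Derivation.map_smul, polyD_X,
    Matrix.toLin'_apply, Matrix.mulVec, dotProduct, Finset.smul_sum, Finset.sum_smul, smul_smul]
  rw [Finset.sum_comm]
  simp only [mul_comm]

theorem poly_gen {S : Submodule K (MvPolynomial σ K)} (h1 : (1 : MvPolynomial σ K) ∈ S)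
    (hX : ∀ p ∈ S, ∀ j, p * X j ∈ S) (p : MvPolynomial σ K) : p ∈ S := by
  induction p using MvPolynomial.induction_on with
  | C a => rw [← mul_one (C a), ← smul_eq_C_mul]; exact S.smul_mem _ h1
  | add p q hp hq => exact S.add_mem hp hq
  | mul_X p j hp => exact hX p hp j

theorem polyD_lnil {L : Matrix σ σ K} (h : ∀ w, w ∈ lnil (Matrix.toLin' L))
    (p : MvPolynomial σ K) : p ∈ lnil (polyD L : MvPolynomial σ K →ₗ[K] MvPolynomial σ K) := by
  refine poly_gen (mem_lnil.2 ⟨1, by simp⟩) (fun p hp j => ?_) p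
  refine lnil_smul (D := polyD L) (n := X j) (fun b n => ?_) hp ?_
  · simp [mul_comm, add_comm]
  · rw [← linX_single]
    exact lnil_transfer linX (fun v => polyD_linX L v) (h _)

theorem polyD_wts {L : Matrix σ σ K} (h : ∀ w, w ∈ wts (Matrix.toLin' L))
    (p : MvPolynomial σ K) : p ∈ wts (polyD L : MvPolynomial σ K →ₗ[K] MvPolynomial σ K) := by
  refine poly_gen (mem_wts_of 0 (by simp)) (fun p hp j => ?_) p
  refine wts_smul (D := polyD L) (n := X j) (fun b n => ?_) hp ?_
  · simp [mul_comm, add_comm]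
  · rw [← linX_single]
    exact wts_transfer linX (fun v => polyD_linX L v) (h _)

theorem SlTwo.poly {E F H : Matrix σ σ K}
    (s : SlTwo (Matrix.toLin' E) (Matrix.toLin' F) (Matrix.toLin' H)) :
    SlTwo (K := K) (V := MvPolynomial σ K) (polyD E) (polyD F) (polyD H) where
  ef v := by
    have : ⁅polyD E, polyD F⁆ = polyD H := derivation_ext fun j => by
      rw [Derivation.commutator_apply, ← linX_single]
      simp only [polyD_linX]
      rw [s.ef, map_add]; simp
    have h := congrArg (fun D => D v) this
    simp only [Derivation.commutator_apply] at h
    simpa [sub_eq_iff_eq_add, add_comm] using h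
  he v := by
    have : ⁅polyD H, polyD E⁆ = (2 : K) • polyD E := derivation_ext fun j => by
      rw [Derivation.commutator_apply, ← linX_single, Derivation.smul_apply]
      simp only [polyD_linX]
      rw [s.he, map_add, map_smul]; simp
    have h := congrArg (fun D => D v) this
    simp only [Derivation.commutator_apply, Derivation.smul_apply] at h
    simpa [sub_eq_iff_eq_add, add_comm] using h
  hf v := by
    have : ⁅polyD H, polyD F⁆ = -((2 : K) • polyD F) := derivation_ext fun j => by
      rw [Derivation.commutator_apply, ← linX_single, Derivation.neg_apply, Derivation.smul_apply]
      simp only [polyD_linX]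
      rw [s.hf, map_sub, map_smul]; simp
    have h := congrArg (fun D => D v) this
    simp only [Derivation.commutator_apply, Derivation.smul_apply, Derivation.neg_apply] at h
    rw [sub_eq_iff_eq_add] at h
    change polyD H (polyD F v) = polyD F (polyD H v) - (2 : K) • polyD F v
    rw [h]; abel
  ne := polyD_lnil s.ne
  nf := polyD_lnil s.nf
  wt := polyD_wts s.wt

end poly

section act
variable {K R ι : Type*} [Field K] [CommRing R] [Algebra K R] [Fintype ι] [DecidableEq ι]

def act (α : Matrix ι ι K) (D : Derivation K R R) : Module.End K (ι → R) where
  toFun m := fun i => (∑ j, α i j • m j) + D (m i)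
  map_add' m n := by
    ext i; simp only [Pi.add_apply, smul_add, Finset.sum_add_distrib, map_add]; abel
  map_smul' c m := by
    ext i
    simp only [Pi.smul_apply, Derivation.map_smul, RingHom.id_apply, smul_add, Finset.smul_sum, smul_comm c]

theorem act_apply (α : Matrix ι ι K) (D : Derivation K R R) (m : ι → R) (i : ι) :
    act α D m i = (∑ j, α i j • m j) + D (m i) := rfl

theorem act_smul (α : Matrix ι ι K) (D : Derivation K R R) (b : R) (n : ι → R) :
    act α D (b • n) = D b • n + b • act α D n := by
  ext i
  simp only [act_apply, Pi.smul_apply, Pi.add_apply, smul_eq_mul, Derivation.leibniz, mul_add,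
    Finset.mul_sum, mul_smul_comm]
  ring

def linA : (ι → K) →ₗ[K] (ι → R) := (Algebra.linearMap K R).compLeft ι

theorem act_linA (α : Matrix ι ι K) (D : Derivation K R R) (w : ι → K) :
    act α D (linA w) = linA (Matrix.toLin' α w) := by
  ext i
  simp [act_apply, linA, Matrix.mulVec, dotProduct, Algebra.smul_def]

theorem act_gen {S : Submodule K (ι → R)} (h : ∀ (b : R) (w : ι → K), b • linA w ∈ S)
    (n : ι → R) : n ∈ S := by
  have : n = ∑ i, n i • linA (K := K) (Pi.single i 1) := by
    ext j
    simp [linA, Finset.sum_apply, Pi.single_apply, apply_ite]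
  rw [this]
  exact Submodule.sum_mem _ fun i _ => h _ _

theorem SlTwo.act {E F H : Matrix ι ι K} {DE DF DH : Derivation K R R}
    (s : SlTwo (Matrix.toLin' E) (Matrix.toLin' F) (Matrix.toLin' H))
    (t : SlTwo (K := K) (V := R) DE DF DH) :
    SlTwo (K := K) (V := ι → R) (act E DE) (act F DF) (act H DH) where
  ef v := by
    refine act_gen (S := LinearMap.eqLocus (_root_.act E DE ∘ₗ _root_.act F DF)
      (_root_.act F DF ∘ₗ _root_.act E DE + _root_.act H DH)) (fun b w => ?_) v
    have h := t.ef b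
    simp only [Derivation.coeFn_coe] at h
    simp only [LinearMap.mem_eqLocus, LinearMap.comp_apply, LinearMap.add_apply, act_smul, map_add,
      act_linA, s.ef, h, add_smul, smul_add]
    abel
  he v := by
    refine act_gen (S := LinearMap.eqLocus (_root_.act H DH ∘ₗ _root_.act E DE)
      (_root_.act E DE ∘ₗ _root_.act H DH + (2 : K) • _root_.act E DE)) (fun b w => ?_) v
    have h := t.he b
    simp only [Derivation.coeFn_coe] at h
    simp only [LinearMap.mem_eqLocus, LinearMap.comp_apply, LinearMap.add_apply, act_smul, map_add,
      act_linA, s.he, h, add_smul, smul_add, LinearMap.smul_apply, smul_assoc, map_smul,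
      smul_comm b (2 : K)]
    abel
  hf v := by
    refine act_gen (S := LinearMap.eqLocus (_root_.act H DH ∘ₗ _root_.act F DF)
      (_root_.act F DF ∘ₗ _root_.act H DH - (2 : K) • _root_.act F DF)) (fun b w => ?_) v
    have h := t.hf b
    simp only [Derivation.coeFn_coe] at h
    simp only [LinearMap.mem_eqLocus, LinearMap.comp_apply, LinearMap.sub_apply, act_smul, map_add,
      act_linA, s.hf, h, sub_smul, smul_sub, smul_add, LinearMap.smul_apply, smul_assoc, map_smul,
      map_sub, smul_comm b (2 : K)]
    abel
  ne := fun v => act_gen (S := lnil _) (fun b w => lnil_smul (act_smul E DE) (t.ne b)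
    (lnil_transfer linA (act_linA E DE) (s.ne w))) v
  nf := fun v => act_gen (S := lnil _) (fun b w => lnil_smul (act_smul F DF) (t.nf b)
    (lnil_transfer linA (act_linA F DF) (s.nf w))) v
  wt := fun v => act_gen (S := wts _) (fun b w => wts_smul (act_smul H DH) (t.wt b)
    (wts_transfer linA (act_linA H DH) (s.wt w))) v

end act

section glue
variable {K : Type*} [Field K]

theorem SlTwo.glue {V1 V2 W : Type*} [AddCommGroup V1] [Module K V1] [AddCommGroup V2]
    [Module K V2] [AddCommGroup W] [Module K W]
    {E1 F1 H1 : Module.End K V1} {E2 F2 H2 : Module.End K V2} {E F H : Module.End K W}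
    (s1 : SlTwo E1 F1 H1) (s2 : SlTwo E2 F2 H2) (j1 : V1 →ₗ[K] W) (j2 : V2 →ₗ[K] W)
    (hj : ∀ w, ∃ a b, w = j1 a + j2 b)
    (e1 : ∀ v, E (j1 v) = j1 (E1 v)) (f1 : ∀ v, F (j1 v) = j1 (F1 v))
    (h1 : ∀ v, H (j1 v) = j1 (H1 v))
    (e2 : ∀ v, E (j2 v) = j2 (E2 v)) (f2 : ∀ v, F (j2 v) = j2 (F2 v))
    (h2 : ∀ v, H (j2 v) = j2 (H2 v)) : SlTwo E F H where
  ef w := by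
    obtain ⟨a, b, rfl⟩ := hj w
    simp only [map_add, e1, f1, h1, e2, f2, h2, s1.ef, s2.ef]; abel
  he w := by
    obtain ⟨a, b, rfl⟩ := hj w
    simp only [map_add, e1, h1, e2, h2, s1.he, s2.he, map_smul, smul_add]; abel
  hf w := by
    obtain ⟨a, b, rfl⟩ := hj w
    simp only [map_add, map_sub, f1, h1, f2, h2, s1.hf, s2.hf, map_smul, smul_add]; abel
  ne w := by
    obtain ⟨a, b, rfl⟩ := hj w
    exact (lnil E).add_mem (lnil_transfer j1 e1 (s1.ne a)) (lnil_transfer j2 e2 (s2.ne b))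
  nf w := by
    obtain ⟨a, b, rfl⟩ := hj w
    exact (lnil F).add_mem (lnil_transfer j1 f1 (s1.nf a)) (lnil_transfer j2 f2 (s2.nf b))
  wt w := by
    obtain ⟨a, b, rfl⟩ := hj w
    exact (wts H).add_mem (wts_transfer j1 h1 (s1.wt a)) (wts_transfer j2 h2 (s2.wt b))

def sumL (m n : Type*) : (m → K) →ₗ[K] (m ⊕ n → K) where
  toFun w := Sum.elim w 0
  map_add' a b := by ext (i | i) <;> simp
  map_smul' a b := by ext (i | i) <;> simp

def sumR (m n : Type*) : (n → K) →ₗ[K] (m ⊕ n → K) where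
  toFun w := Sum.elim 0 w
  map_add' a b := by ext (i | i) <;> simp
  map_smul' a b := by ext (i | i) <;> simp

theorem SlTwo.blocks {m n : Type*} [Fintype m] [Fintype n] [DecidableEq m] [DecidableEq n]
    {E1 F1 H1 : Matrix m m K} {E2 F2 H2 : Matrix n n K}
    (s1 : SlTwo (Matrix.toLin' E1) (Matrix.toLin' F1) (Matrix.toLin' H1))
    (s2 : SlTwo (Matrix.toLin' E2) (Matrix.toLin' F2) (Matrix.toLin' H2)) :
    SlTwo (Matrix.toLin' (Matrix.fromBlocks E1 0 0 E2)) (Matrix.toLin' (Matrix.fromBlocks F1 0 0 F2))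
      (Matrix.toLin' (Matrix.fromBlocks H1 0 0 H2)) := by
  have hl : ∀ (A : Matrix m m K) (B : Matrix n n K) (v : m → K),
      Matrix.toLin' (Matrix.fromBlocks A 0 0 B) (sumL m n v) = sumL m n (Matrix.toLin' A v) := by
    intro A B v
    ext (i | i) <;> simp [sumL, Matrix.fromBlocks_mulVec]
  have hr : ∀ (A : Matrix m m K) (B : Matrix n n K) (v : n → K),
      Matrix.toLin' (Matrix.fromBlocks A 0 0 B) (sumR m n v) = sumR m n (Matrix.toLin' B v) := by
    intro A B v
    ext (i | i) <;> simp [sumR, Matrix.fromBlocks_mulVec]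
  refine s1.glue s2 (sumL m n) (sumR m n) (fun w => ⟨w ∘ Sum.inl, w ∘ Sum.inr, ?_⟩)
    (hl _ _) (hl _ _) (hl _ _) (hr _ _) (hr _ _) (hr _ _)
  ext (i | i) <;> simp [sumL, sumR]

def eTwo (K : Type*) [Field K] : Matrix (Fin 2) (Fin 2) K := !![0, 1; 0, 0]
def fTwo (K : Type*) [Field K] : Matrix (Fin 2) (Fin 2) K := !![0, 0; 1, 0]
def hTwo (K : Type*) [Field K] : Matrix (Fin 2) (Fin 2) K := !![1, 0; 0, -1]

theorem slTwo_two : SlTwo (Matrix.toLin' (eTwo K)) (Matrix.toLin' (fTwo K))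
    (Matrix.toLin' (hTwo K)) where
  ef v := by ext i; fin_cases i <;> simp [eTwo, fTwo, hTwo, Matrix.mulVec, dotProduct]
  he v := by ext i; fin_cases i <;> simp [eTwo, hTwo, Matrix.mulVec, dotProduct]; ring
  hf v := by ext i; fin_cases i <;> simp [fTwo, hTwo, Matrix.mulVec, dotProduct]; ring
  ne v := ⟨2, by
    rw [pow_two]; ext i; fin_cases i <;> simp [eTwo, Matrix.mulVec, dotProduct]⟩
  nf v := ⟨2, by
    rw [pow_two]; ext i; fin_cases i <;> simp [fTwo, Matrix.mulVec, dotProduct]⟩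
  wt v := by
    have : v = ![v 0, 0] + ![0, v 1] := by ext i; fin_cases i <;> simp
    rw [this]
    refine (wts (Matrix.toLin' (hTwo K))).add_mem (mem_wts_of 1 ?_) (mem_wts_of (-1) ?_)
    · ext i; fin_cases i <;> simp [hTwo, Matrix.mulVec, dotProduct]
    · ext i; fin_cases i <;> simp [hTwo, Matrix.mulVec, dotProduct]

end glue

section inter
variable {K : Type*} [Field K]

theorem inter_of_X {σ S : Type*} [CommRing S] [Algebra K S] (φ : MvPolynomial σ K →ₐ[K] S)
    (D : Derivation K (MvPolynomial σ K) (MvPolynomial σ K)) (D' : Derivation K S S)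
    (h : ∀ j, D' (φ (MvPolynomial.X j)) = φ (D (MvPolynomial.X j))) (p : MvPolynomial σ K) :
    D' (φ p) = φ (D p) := by
  induction p using MvPolynomial.induction_on with
  | C a =>
    rw [← MvPolynomial.algebraMap_eq, AlgHom.commutes, Derivation.map_algebraMap,
      Derivation.map_algebraMap, map_zero]
  | add p q hp hq => simp only [map_add, hp, hq]
  | mul_X p j hp => simp only [map_mul, Derivation.leibniz, map_add, smul_eq_mul, hp, h]

def mapN {R S : Type*} [CommRing R] [Algebra K R] [CommRing S] [Algebra K S] (φ : R →ₐ[K] S)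
    (ι : Type*) : (ι → R) →ₗ[K] (ι → S) := φ.toLinearMap.compLeft ι

theorem mapN_apply {R S : Type*} [CommRing R] [Algebra K R] [CommRing S] [Algebra K S]
    (φ : R →ₐ[K] S) {ι : Type*} (n : ι → R) (i : ι) : mapN φ ι n i = φ (n i) := rfl

theorem mapN_smul {R S : Type*} [CommRing R] [Algebra K R] [CommRing S] [Algebra K S]
    (φ : R →ₐ[K] S) {ι : Type*} (b : R) (n : ι → R) :
    mapN φ ι (b • n) = φ b • mapN φ ι n := by
  ext i; simp [mapN_apply]

theorem act_mapN {R S : Type*} [CommRing R] [Algebra K R] [CommRing S] [Algebra K S]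
    (φ : R →ₐ[K] S) {ι : Type*} [Fintype ι] [DecidableEq ι] (α : Matrix ι ι K)
    {D : Derivation K R R} {D' : Derivation K S S} (h : ∀ r, D' (φ r) = φ (D r)) (n : ι → R) :
    act α D' (mapN φ ι n) = mapN φ ι (act α D n) := by
  ext i; simp [mapN_apply, act_apply, h]

end inter

theorem wt_decomp' {K V : Type*} [Field K] [AddCommGroup V] [Module K V]
    (T : Module.End K V) {v : V} (hv : v ∈ wts T) :
    ∃ f : ℤ →₀ V, (∀ p, T (f p) = (p : K) • f p) ∧ v = ∑ p ∈ f.support, f p := by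
  classical
  obtain ⟨f, hf, h⟩ := (Submodule.mem_iSup_iff_exists_finsupp _ _).1 hv
  exact ⟨f, fun p => Module.End.mem_eigenspace_iff.1 (hf p), h.symm⟩

theorem SlTwo.reynolds_step {K B ι : Type*} [Field K] [CharZero K] [CommRing B] [Algebra K B]
    [Fintype ι] [DecidableEq ι]
    {E F H : Matrix ι ι K} {DE DF DH : Derivation K B B}
    (t : SlTwo (K := K) (V := B) DE DF DH) {k : ℕ} (g : Fin k → (ι → B))
    (hE : ∀ a, _root_.act E DE (g a) = 0) (hF : ∀ a, _root_.act F DF (g a) = 0)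
    (hH : ∀ a, _root_.act H DH (g a) = 0) (n : ι → B) (nE : _root_.act E DE n = 0)
    (nH : _root_.act H DH n = 0) (c : Fin k → B) (hc : n = ∑ a, c a • g a) :
    ∃ b : Fin k → B, (∀ a, DE (b a) = 0) ∧ n = ∑ a, b a • g a := by
  classical
  choose f hf hcf using fun a => wt_decomp' (K := K) (DH : B →ₗ[K] B) (t.wt (c a))
  let S : Finset ℤ := insert 0 (Finset.univ.biUnion fun a => (f a).support)
  have hcS : ∀ a, c a = ∑ p ∈ S, f a p := by
    intro a
    rw [hcf a]
    refine Finset.sum_subset (fun p hp => ?_) (fun p _ hp => by simpa using hp)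
    exact Finset.mem_insert_of_mem (Finset.mem_biUnion.2 ⟨a, Finset.mem_univ _, hp⟩)
  have hzero : n = ∑ a, f a 0 • g a := by
    have hw := wt_indep (K := K) (_root_.act H DH) S
      (fun p => (∑ a, f a p • g a) - (if p = 0 then n else 0)) ?_ ?_ 0 (Finset.mem_insert_self _ _)
    · simp only [if_true] at hw
      exact (sub_eq_zero.1 hw).symm
    · intro p
      have h1 : ∀ a, DH (f a p) = (p : K) • f a p := fun a => hf a p
      rw [map_sub, map_sum, smul_sub, Finset.smul_sum]
      congr 1
      · refine Finset.sum_congr rfl fun a _ => ?_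
        rw [act_smul, hH, smul_zero, add_zero, h1, smul_assoc]
      · split_ifs with h
        · rw [nH, h]; simp
        · simp
    · rw [Finset.sum_sub_distrib, Finset.sum_comm]
      simp only [← Finset.sum_smul, ← hcS, ← hc]
      rw [Finset.sum_ite_eq' S 0, if_pos (Finset.mem_insert_self _ _), sub_self]
  have hwt0 : ∀ a, DH (f a 0) = 0 := fun a => by simpa using hf a 0
  choose m hm using fun a => t.ne (f a 0)
  let M := Finset.univ.sup m + 1
  have hM : ∀ a, ((DE : B →ₗ[K] B) ^ M) (f a 0) = 0 := fun a =>
    pow_zero_mono _ (le_trans (Finset.le_sup (Finset.mem_univ a)) (Nat.le_succ _)) (hm a)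
  refine ⟨fun a => reyn (DE : B →ₗ[K] B) DF M (f a 0), fun a => t.reyn_E M _ (hwt0 a) (hM a), ?_⟩
  have hpow : ∀ (T : Matrix ι ι K) (D : Derivation K B B) (x : ι → B), _root_.act T D x = 0 →
      ∀ (j : ℕ) (b : B), ((_root_.act T D) ^ j) (b • x) = (((D : B →ₗ[K] B) ^ j) b) • x := by
    intro T D x hx j
    induction j with
    | zero => intro b; simp
    | succ j ih =>
      intro b
      rw [pow_succ, Module.End.mul_apply, act_smul, hx, smul_zero, add_zero, ih, pow_succ,
        Module.End.mul_apply]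
      rfl
  have h1 : reyn (_root_.act E DE) (_root_.act F DF) M n = n := by
    unfold reyn
    rw [Finset.sum_range_succ', Finset.sum_eq_zero]
    · simp [rc]
    · intro j _
      rw [pow_succ, pow_succ (_root_.act E DE), Module.End.mul_apply (_ ^ j) (_root_.act E DE), nE,
        map_zero, map_zero, smul_zero]
  have h2 : reyn (_root_.act E DE) (_root_.act F DF) M n
      = ∑ a, reyn (DE : B →ₗ[K] B) DF M (f a 0) • g a := by
    unfold reyn
    simp only [Finset.sum_smul]
    rw [Finset.sum_comm]
    refine Finset.sum_congr rfl fun j _ => ?_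
    conv_lhs => rw [hzero]
    rw [map_sum, map_sum, Finset.smul_sum]
    refine Finset.sum_congr rfl fun a _ => ?_
    rw [hpow _ _ _ (hE a), hpow _ _ _ (hF a), smul_assoc]
  rw [← h2, h1]

/-- Finite generation of invariants, Hilbert style. -/
theorem SlTwo.invariants_fg {K B ι : Type*} [Field K] [CharZero K] [CommRing B] [Algebra K B]
    [IsNoetherianRing B] [Fintype ι] [DecidableEq ι]
    {E F H : Matrix ι ι K} {DE DF DH : Derivation K B B}
    (t : SlTwo (K := K) (V := B) DE DF DH)
    (s : SlTwo (K := K) (V := ι → B) (_root_.act E DE) (_root_.act F DF) (_root_.act H DH)) :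
    ∃ (k : ℕ) (g : Fin k → (ι → B)),
      (∀ a, _root_.act E DE (g a) = 0 ∧ _root_.act H DH (g a) = 0) ∧
      ∀ n : ι → B, _root_.act E DE n = 0 → _root_.act H DH n = 0 →
        ∃ b : Fin k → B, (∀ a, DE (b a) = 0) ∧ n = ∑ a, b a • g a := by
  classical
  let S : Set (ι → B) := {n | _root_.act E DE n = 0 ∧ _root_.act H DH n = 0}
  have hF : ∀ n ∈ S, _root_.act F DF n = 0 := by
    rintro n ⟨h1, h2⟩
    by_cases h0 : n = 0
    · rw [h0, map_zero]
    obtain ⟨q, hq, h⟩ := s.hw 0 h1 (by rw [h2]; simp) h0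
    obtain rfl : q = 0 := by omega
    simpa using h
  have hfg : (Submodule.span B S).FG := IsNoetherian.noetherian _
  obtain ⟨G, hGS, hG⟩ := (Submodule.fg_span_iff_fg_span_finset_subset S).1 hfg
  let e := G.equivFin.symm
  refine ⟨G.card, fun a => (e a : ι → B), fun a => hGS (e a).2, ?_⟩
  intro n hnE hnH
  have hmem : n ∈ Submodule.span B (Set.range fun a => (e a : ι → B)) := by
    have : (Set.range fun a => (e a : ι → B)) = (G : Set (ι → B)) := by
      ext x; constructor
      · rintro ⟨a, rfl⟩; exact (e a).2
      · intro hx; exact ⟨e.symm ⟨x, hx⟩, by simp⟩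
    rw [this, ← hG]
    exact Submodule.subset_span ⟨hnE, hnH⟩
  obtain ⟨c, hc⟩ := (Submodule.mem_span_range_iff_exists_fun B).1 hmem
  have hg : ∀ a, (e a : ι → B) ∈ S := fun a => hGS (e a).2
  exact t.reynolds_step (fun a => (e a : ι → B)) (fun a => (hg a).1) (fun a => hF _ (hg a))
    (fun a => (hg a).2) n hnE hnH c hc.symm

theorem SlTwo.h_powF {K V : Type*} [Field K] [AddCommGroup V] [Module K V]
    {E F H : Module.End K V} (s : SlTwo E F H) (k : ℕ) (v : V) (p : K) (hv : H v = p • v) :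
    H ((F ^ k) v) = (p - 2 * k) • (F ^ k) v := by
  induction k with
  | zero => simp [hv]
  | succ k ih =>
    rw [pow_succ', Module.End.mul_apply, s.hf, ih, map_smul]
    push_cast
    module

/-- Lifting a highest weight vector to an invariant. -/
theorem SlTwo.lift {K V B N : Type*} [Field K] [CharZero K] [AddCommGroup V] [Module K V]
    [CommRing B] [Algebra K B] [AddCommGroup N] [Module K N] [Module B N] [IsScalarTower K B N]
    {E F H : Module.End K V} (s : SlTwo E F H) {DE DH : Derivation K B B} {TE TH : Module.End K N}
    (lE : ∀ (b : B) (n : N), TE (b • n) = DE b • n + b • TE n)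
    (lH : ∀ (b : B) (n : N), TH (b • n) = DH b • n + b • TH n)
    (j : V →ₗ[K] N) (jE : ∀ v, TE (j v) = j (E v)) (jH : ∀ v, TH (j v) = j (H v))
    (x y : B) (Ex : DE x = 0) (Ey : DE y = x) (Hx : DH x = x) (Hy : DH y = -y)
    (q : ℕ) (v : V) (vE : E v = 0) (vH : H v = (q : K) • v) :
    ∃ n : N, TE n = 0 ∧ TH n = 0 ∧ ∃ n', n = y ^ q • j v + x • n' := by
  let c : ℕ → K := fun i => (-1) ^ i / (i.factorial : K)
  have hc : ∀ i, c (i + 1) * ((i : K) + 1) = - c i := by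
    intro i
    have h1 : (i.factorial : K) ≠ 0 := Nat.cast_ne_zero.2 i.factorial_ne_zero
    have h2 : (i : K) + 1 ≠ 0 := Nat.cast_add_one_ne_zero i
    simp only [c, Nat.factorial_succ]
    push_cast
    field_simp
    ring
  have wE : ∀ i r : ℕ, DE (x ^ i * y ^ r) = (r : K) • (x ^ (i + 1) * y ^ (r - 1)) := by
    intro i r
    rw [Derivation.leibniz, Derivation.leibniz_pow, Derivation.leibniz_pow, Ex, Ey]
    simp only [smul_zero, add_zero, smul_eq_mul, nsmul_eq_mul]
    simp only [Algebra.smul_def, map_natCast]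
    ring
  have wH : ∀ i r : ℕ, DH (x ^ i * y ^ r) = ((i : K) - r) • (x ^ i * y ^ r) := by
    have hp : ∀ (z : B) (e : ℤ) (k : ℕ), DH z = e • z → DH (z ^ k) = (e * k : ℤ) • z ^ k := by
      intro z e k hz
      rcases k with _ | k
      · simp
      · rw [Derivation.leibniz_pow, hz]
        simp only [smul_eq_mul, nsmul_eq_mul, zsmul_eq_mul, Nat.add_sub_cancel]
        push_cast
        ring
    intro i r
    rw [Derivation.leibniz, hp x 1 i (by simpa using Hx), hp y (-1) r (by simpa using Hy)]
    simp only [smul_eq_mul, zsmul_eq_mul, Algebra.smul_def, map_sub, map_natCast]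
    push_cast
    ring
  let f : ℕ → N := fun i => c i • ((x ^ i * y ^ (q - i)) • j ((F ^ i) v))
  refine ⟨∑ i ∈ Finset.range (q + 1), f i, ?_, ?_, ?_⟩
  · have key : ∀ k ≤ q, TE (∑ i ∈ Finset.range (k + 1), f i)
        = (c k * ((q : K) - k)) • ((x ^ (k + 1) * y ^ (q - k - 1)) • j ((F ^ k) v)) := by
      intro k
      induction k with
      | zero =>
        intro _
        simp only [zero_add, Finset.sum_range_one, f]
        rw [map_smul, lE, wE, jE]
        simp [vE, smul_smul]
      | succ k ih =>
        intro hk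
        rw [Finset.sum_range_succ, map_add, ih (by omega)]
        simp only [f]
        rw [map_smul, lE, wE, jE, s.ef_pow, vE, vH, map_zero, zero_add, map_smul,
          Nat.cast_sub hk, ← Nat.sub_sub q k 1, map_sub, map_smul, map_smul, map_smul,
          smul_sub, smul_assoc, smul_comm (x ^ (k + 1) * y ^ (q - k - 1)),
          smul_comm (x ^ (k + 1) * y ^ (q - k - 1)), smul_comm (x ^ (k + 1) * y ^ (q - k - 1))]
        rw [show c k = -(c (k + 1) * ((k : K) + 1)) by rw [hc, neg_neg]]
        push_cast
        module
    rw [key q le_rfl, sub_self, mul_zero, zero_smul]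
  · rw [map_sum]
    refine Finset.sum_eq_zero fun i hi => ?_
    have hiq : i ≤ q := Nat.lt_succ_iff.1 (Finset.mem_range.1 hi)
    simp only [f]
    rw [map_smul, lH, wH, jH, s.h_powF i v _ vH, map_smul, Nat.cast_sub hiq, smul_assoc,
      smul_comm (x ^ i * y ^ (q - i))]
    rw [← add_smul, show (i : K) - ((q : K) - i) + ((q : K) - 2 * i) = 0 by ring, zero_smul,
      smul_zero]
  · refine ⟨∑ i ∈ Finset.range q, c (i + 1) • ((x ^ i * y ^ (q - (i + 1))) • j ((F ^ (i + 1)) v)),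
      ?_⟩
    rw [Finset.sum_range_succ', add_comm, Finset.smul_sum]
    congr 1
    · simp [f, c]
    · refine Finset.sum_congr rfl fun i _ => ?_
      simp only [f]
      rw [smul_comm x, smul_smul x, pow_succ', mul_assoc]

section comparison
variable {K σ : Type*} [Field K] [Fintype σ] [DecidableEq σ]

def incP (K σ : Type*) [Field K] : MvPolynomial σ K →ₐ[K] MvPolynomial (σ ⊕ Fin 2) K :=
  MvPolynomial.rename Sum.inl

def evP (K σ : Type*) [Field K] : MvPolynomial (σ ⊕ Fin 2) K →ₐ[K] MvPolynomial σ K :=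
  MvPolynomial.aeval (Sum.elim MvPolynomial.X ![0, 1])

theorem incP_X (j : σ) : incP K σ (MvPolynomial.X j) = MvPolynomial.X (Sum.inl j) :=
  MvPolynomial.rename_X _ _

theorem evP_X (j : σ) : evP K σ (MvPolynomial.X (Sum.inl j)) = MvPolynomial.X j :=
  (MvPolynomial.aeval_X _ _).trans rfl

theorem evP_x : evP K σ (MvPolynomial.X (Sum.inr 0)) = 0 :=
  (MvPolynomial.aeval_X _ _).trans rfl

theorem evP_y : evP K σ (MvPolynomial.X (Sum.inr 1)) = 1 :=
  (MvPolynomial.aeval_X _ _).trans rfl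

theorem evP_incP (p : MvPolynomial σ K) : evP K σ (incP K σ p) = p := by
  have : (evP K σ).comp (incP K σ) = AlgHom.id K _ :=
    MvPolynomial.algHom_ext fun j => by
      rw [AlgHom.comp_apply, incP_X, evP_X, AlgHom.id_apply]
  exact DFunLike.congr_fun this p

theorem hincP (L : Matrix σ σ K) (e : Matrix (Fin 2) (Fin 2) K)
    (p : MvPolynomial σ K) :
    polyD (Matrix.fromBlocks L 0 0 e) (incP K σ p) = incP K σ (polyD L p) := by
  revert p
  refine inter_of_X (incP K σ) _ _ fun j => ?_
  rw [incP_X, polyD_X, polyD_X, map_sum, Fintype.sum_sum_type]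
  simp [incP_X]

theorem hevP (L : Matrix σ σ K) (p : MvPolynomial (σ ⊕ Fin 2) K) :
    polyD L (evP K σ p) = evP K σ (polyD (Matrix.fromBlocks L 0 0 (eTwo K)) p) := by
  revert p
  refine inter_of_X (evP K σ) _ _ ?_
  rintro (j | j)
  · rw [evP_X, polyD_X, polyD_X, map_sum, Fintype.sum_sum_type]
    simp [evP_X]
  · rw [polyD_X, map_sum, Fintype.sum_sum_type]
    fin_cases j
    · simp [evP_x, eTwo]
    · simp [evP_x, evP_y, eTwo]

end comparison

theorem constants_of_Md_finitely_generated
    (K : Type*) [Field K] [CharZero K] (d : ℕ) (hd : 2 ≤ d)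
    (α : Matrix (Fin d) (Fin d) K) (hnil : IsNilpotent α) (hne : α ≠ 0)
    (δ' : Derivation K (PolyUV K d) (PolyUV K d))
    (hu : ∀ j, δ' (uP K d j) = ∑ i, α i j • uP K d i)
    (hv : ∀ j, δ' (vP K d j) = ∑ i, α i j • vP K d i) :
    ∃ (n : ℕ) (s : Fin n → Md K d),
      (∀ t, deltaM K d α δ' (s t) = 0) ∧
      ∀ m : Md K d, deltaM K d α δ' m = 0 →
        ∃ h : Fin n → PolyUV K d,
          (∀ t, δ' (h t) = 0) ∧ m = ∑ t, h t • s t := by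
  classical
  obtain ⟨F0, H0, s0⟩ := exists_slTwo (Matrix.toLin' α) (by
    obtain ⟨k, hk⟩ := hnil
    exact ⟨k, by rw [← Matrix.toLin'_pow, hk, map_zero]⟩)
  obtain ⟨φ, rfl⟩ := Matrix.toLin'.surjective F0
  obtain ⟨η, rfl⟩ := Matrix.toLin'.surjective H0
  have sL := s0.blocks s0
  have sA := sL.poly
  have sM := s0.act sA
  have sB := (sL.blocks slTwo_two).poly
  have sN := s0.act sB
  have hδ : δ' = polyD (Matrix.fromBlocks α 0 0 α) := by
    refine MvPolynomial.derivation_ext ?_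
    rintro (j | j)
    · rw [polyD_X]; simpa [uP] using hu j
    · rw [polyD_X]; simpa [vP] using hv j
  have hδM : ∀ m, deltaM K d α δ' m = act α (polyD (Matrix.fromBlocks α 0 0 α)) m := by
    intro m; rw [hδ]; rfl
  simp only [hδM]
  subst hδ
  -- the two comparison maps
  let inc : PolyUV K d →ₐ[K] MvPolynomial ((Fin d ⊕ Fin d) ⊕ Fin 2) K := incP K (Fin d ⊕ Fin d)
  let ev : MvPolynomial ((Fin d ⊕ Fin d) ⊕ Fin 2) K →ₐ[K] PolyUV K d := evP K (Fin d ⊕ Fin d)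
  have hinc : ∀ (L : Matrix (Fin d ⊕ Fin d) (Fin d ⊕ Fin d) K) (e : Matrix (Fin 2) (Fin 2) K)
      (p : PolyUV K d), polyD (Matrix.fromBlocks L 0 0 e) (inc p) = inc (polyD L p) := hincP
  have hev : ∀ (L : Matrix (Fin d ⊕ Fin d) (Fin d ⊕ Fin d) K)
      (p : MvPolynomial ((Fin d ⊕ Fin d) ⊕ Fin 2) K),
      polyD L (ev p) = ev (polyD (Matrix.fromBlocks L 0 0 (eTwo K)) p) := hevP
  have hevinc : ∀ p, ev (inc p) = p := evP_incP
  let x : MvPolynomial ((Fin d ⊕ Fin d) ⊕ Fin 2) K := MvPolynomial.X (Sum.inr 0)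
  let y : MvPolynomial ((Fin d ⊕ Fin d) ⊕ Fin 2) K := MvPolynomial.X (Sum.inr 1)
  have evx : ev x = 0 := evP_x
  have evy : ev y = 1 := evP_y
  obtain ⟨k, g, hg, hgen⟩ := sB.invariants_fg sN
  refine ⟨k, fun a => mapN ev (Fin d) (g a), fun a => ?_, fun m hm => ?_⟩
  · rw [act_mapN ev α (hev _), (hg a).1, map_zero]
  -- reduce to weight vectors
  obtain ⟨S, f, hf, rfl⟩ := wt_decomp _ (sM.wt m)
  have hfE : ∀ p ∈ S, act α (polyD (Matrix.fromBlocks α 0 0 α)) (f p) = 0 := by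
    have hinj : Function.Injective fun p : ℤ => p + 2 := fun a b h => by simpa using h
    have := wt_indep (K := K) (act η (polyD (Matrix.fromBlocks η 0 0 η)))
      (S.image fun p => p + 2)
      (fun p => act α (polyD (Matrix.fromBlocks α 0 0 α)) (f (p - 2))) ?_ ?_
    · intro p hp
      simpa using this (p + 2) (Finset.mem_image_of_mem _ hp)
    · intro p
      rw [sM.he, hf, map_smul, ← add_smul]
      push_cast
      congr 1
      ring
    · rw [Finset.sum_image (fun a _ b _ h => hinj h)]
      simpa [map_sum] using hm
  have main : ∀ p ∈ S, ∃ h : Fin k → PolyUV K d,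
      (∀ t, polyD (Matrix.fromBlocks α 0 0 α) (h t) = 0) ∧
      f p = ∑ t, h t • mapN ev (Fin d) (g t) := by
    intro p hp
    by_cases h0 : f p = 0
    · exact ⟨0, by simp, by simp [h0]⟩
    obtain ⟨q, rfl, -⟩ := sM.hw p (hfE p hp) (hf p) h0
    obtain ⟨n, nE, nH, n', hn⟩ := sM.lift (act_smul α (polyD (Matrix.fromBlocks _ 0 0 (eTwo K))))
      (act_smul η (polyD (Matrix.fromBlocks _ 0 0 (hTwo K)))) (mapN inc (Fin d))
      (act_mapN inc α (hinc _ _)) (act_mapN inc η (hinc _ _)) x y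
      (by simp [x, polyD_X, eTwo]) (by simp [x, y, polyD_X, eTwo]) (by simp [x, polyD_X, hTwo])
      (by simp [y, polyD_X, hTwo]) q (f q) (hfE _ hp) (by simpa using hf q)
    obtain ⟨b, hb, hnb⟩ := hgen n nE nH
    refine ⟨fun a => ev (b a), fun a => by rw [hev, hb, map_zero], ?_⟩
    have h1 : mapN ev (Fin d) n = f q := by
      rw [hn, map_add, mapN_smul, mapN_smul, map_pow, evx, evy, one_pow, one_smul, zero_smul,
        add_zero]
      ext1 i
      simp only [mapN_apply, hevinc]
    rw [← h1, hnb, map_sum]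
    simp only [mapN_smul]
  choose! h hh1 hh2 using main
  refine ⟨fun t => ∑ p ∈ S, h p t, fun t => ?_, ?_⟩
  · rw [map_sum]
    exact Finset.sum_eq_zero fun p hp => hh1 p hp t
  · rw [Finset.sum_congr rfl hh2, Finset.sum_comm]
    simp only [Finset.sum_smul]
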